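/- arXiv:2307.16079 — 6 statements merged into one kernel-verified Lean document; each statement's English description precedes it below -/
import Mathlib

section
/- Let L > 0, let V, κ : ℝ → ℝ be continuous L-periodic functions with ∫_0^L κ(ς) dς = 2π, let τ₀ ∈ ℂ have |τ₀| = 1, and set ν(s) = i τ₀ exp( i ∫_0^s κ(ς) dς ). Then for every w ∈ L²((0,L); ℂ) the following are equivalent: (a) ⟨w, f_{m,V−κ}⟩_{L²(0,L)} = 0 for every m ∈ ℤ with μ_m(V−κ, L) < 0; (b) the function h(s) = conj(ν(s)) · w(s) satisfies ⟨h, f_{m,V}⟩_{L²(0,L)} = 0 for every m ∈ ℤ with μ_m(V, L) < 0. -/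
open MeasureTheory

/-- The mean flux `Φ_V = (1/(2π)) ∫_0^L V`. -/
noncomputable def fluxV (L : ℝ) (V : ℝ → ℝ) : ℝ :=
  (1 / (2 * Real.pi)) * ∫ ς in (0:ℝ)..L, V ς

/-- The eigenvalues `μ_m(V,L) = (2π/L)(m + Φ_V)`. -/
noncomputable def muV (L : ℝ) (V : ℝ → ℝ) (m : ℤ) : ℝ :=
  (2 * Real.pi / L) * ((m : ℝ) + fluxV L V)

/-- The eigenfunctions `f_{m,V}(s) = L^{-1/2} exp(i μ_m(V,L) s - i ∫_0^s V)`. -/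
noncomputable def fmV (L : ℝ) (V : ℝ → ℝ) (m : ℤ) (s : ℝ) : ℂ :=
  ((Real.sqrt L)⁻¹ : ℂ) *
    Complex.exp (Complex.I * ((muV L V m * s - ∫ ς in (0:ℝ)..s, V ς : ℝ) : ℂ))

lemma fluxV_sub {L : ℝ} {V κ : ℝ → ℝ} (hV : Continuous V) (hκ : Continuous κ)
    (hκint : (∫ ς in (0:ℝ)..L, κ ς) = 2 * Real.pi) :
    fluxV L (V - κ) = fluxV L V - 1 := by
  simp only [fluxV, Pi.sub_apply]
  rw [intervalIntegral.integral_sub (hV.intervalIntegrable _ _) (hκ.intervalIntegrable _ _), hκint]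
  field_simp [Real.pi_ne_zero]

lemma muV_sub_add_one {L : ℝ} {V κ : ℝ → ℝ} (hV : Continuous V) (hκ : Continuous κ)
    (hκint : (∫ ς in (0:ℝ)..L, κ ς) = 2 * Real.pi) (m : ℤ) :
    muV L (V - κ) (m + 1) = muV L V m := by
  rw [muV, muV, fluxV_sub hV hκ hκint]
  push_cast
  ring

lemma fmV_sub_add_one {L : ℝ} {V κ : ℝ → ℝ} (hV : Continuous V) (hκ : Continuous κ)
    (hκint : (∫ ς in (0:ℝ)..L, κ ς) = 2 * Real.pi) (m : ℤ) (s : ℝ) :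
    fmV L (V - κ) (m + 1) s =
      Complex.exp (Complex.I * ((∫ ς in (0:ℝ)..s, κ ς : ℝ) : ℂ)) * fmV L V m s := by
  simp only [fmV, muV_sub_add_one hV hκ hκint, Pi.sub_apply]
  rw [intervalIntegral.integral_sub (hV.intervalIntegrable _ _) (hκ.intervalIntegrable _ _),
    mul_left_comm, ← Complex.exp_add]
  congr 2
  push_cast
  ring

/-- Duality between the projections associated with `V - κ` and `V`:
`w ⊥ f_{m,V-κ}` for all negative modes iff `h = conj(ν) w ⊥ f_{m,V}` for all negative modes. -/
theorem stmt_5 (L : ℝ) (hL : 0 < L) (V κ : ℝ → ℝ)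
    (hVc : Continuous V) (hVper : ∀ s, V (s + L) = V s)
    (hκc : Continuous κ) (hκper : ∀ s, κ (s + L) = κ s)
    (hκint : (∫ ς in (0:ℝ)..L, κ ς) = 2 * Real.pi)
    (τ₀ : ℂ) (hτ₀ : ‖τ₀‖ = 1)
    (ν : ℝ → ℂ)
    (hν : ∀ s : ℝ, ν s = Complex.I * τ₀ *
      Complex.exp (Complex.I * ((∫ ς in (0:ℝ)..s, κ ς : ℝ) : ℂ)))
    (w : ℝ → ℂ) (hw : MemLp w 2 (volume.restrict (Set.Ioo (0:ℝ) L))) :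
    ((∀ m : ℤ, muV L (V - κ) m < 0 →
        (∫ s in (0:ℝ)..L, w s * (starRingEnd ℂ) (fmV L (V - κ) m s)) = 0) ↔
     (∀ m : ℤ, muV L V m < 0 →
        (∫ s in (0:ℝ)..L, ((starRingEnd ℂ) (ν s) * w s) * (starRingEnd ℂ) (fmV L V m s)) = 0)) := by
  have hc : (starRingEnd ℂ) (Complex.I * τ₀) ≠ 0 := by
    have hτ : τ₀ ≠ 0 := norm_ne_zero_iff.mp (by rw [hτ₀]; exact one_ne_zero)
    exact (map_ne_zero _).mpr (mul_ne_zero Complex.I_ne_zero hτ)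
  have hmode : ∀ m : ℤ,
      (∫ s in (0:ℝ)..L, ((starRingEnd ℂ) (ν s) * w s) * (starRingEnd ℂ) (fmV L V m s)) =
        (starRingEnd ℂ) (Complex.I * τ₀) *
          ∫ s in (0:ℝ)..L, w s * (starRingEnd ℂ) (fmV L (V - κ) (m + 1) s) := by
    intro m
    rw [← intervalIntegral.integral_const_mul]
    congr 1
    funext s
    rw [fmV_sub_add_one hVc hκc hκint, hν]
    simp only [map_mul]
    ring
  rw [← (Equiv.addRight (1 : ℤ)).forall_congr_right]
  refine forall_congr' fun m => ?_
  rw [Equiv.coe_addRight, muV_sub_add_one hVc hκc hκint, hmode, mul_eq_zero, or_iff_right hc]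
end

section
/- Let g : ℝ → ℝ be continuous and 2π-periodic. For every complex-valued function u that is smooth on an open neighbourhood of the closed unit disc, one has ∫_D ( |(−i∇ − A)u|² − B |u|² ) dx + ∫_0^{2π} g(θ) |u(e^{iθ})|² dθ = 4 ∫_D | ∂_{z̄} u + (∂_{z̄} φ) u |² dx + ∫_0^{2π} [ g(θ) |u(e^{iθ})|² + Re( conj(u) · ( τ · (−i∇ − A)u ) )(e^{iθ}) ] dθ, where τ · (−i∇ − A)u = τ₁ (−i∂₁ − A₁)u + τ₂ (−i∂₂ − A₂)u and |(−i∇−A)u|² = |(−i∂₁ − A₁)u|² + |(−i∂₂ − A₂)u|². -/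
open MeasureTheory

/-- Partial derivative `∂₁` of a function on `ℂ ≅ ℝ²` (direction `1`). -/
noncomputable def pd1 (u : ℂ → ℂ) (z : ℂ) : ℂ := fderiv ℝ u z 1

/-- Partial derivative `∂₂` of a function on `ℂ ≅ ℝ²` (direction `i`). -/
noncomputable def pd2 (u : ℂ → ℂ) (z : ℂ) : ℂ := fderiv ℝ u z Complex.I

/-- Partial derivative `∂₁` of a real-valued function on `ℂ ≅ ℝ²`. -/
noncomputable def pd1R (φ : ℂ → ℝ) (z : ℂ) : ℝ := fderiv ℝ φ z 1

/-- Partial derivative `∂₂` of a real-valued function on `ℂ ≅ ℝ²`. -/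
noncomputable def pd2R (φ : ℂ → ℝ) (z : ℂ) : ℝ := fderiv ℝ φ z Complex.I

/-- First component of the vector potential `A = (-∂₂φ, ∂₁φ)`. -/
noncomputable def A1f (φ : ℂ → ℝ) (z : ℂ) : ℝ := -(pd2R φ z)

/-- Second component of the vector potential `A = (-∂₂φ, ∂₁φ)`. -/
noncomputable def A2f (φ : ℂ → ℝ) (z : ℂ) : ℝ := pd1R φ z

/-- The magnetic field `B = Δφ = ∂₁∂₁φ + ∂₂∂₂φ`. -/
noncomputable def Bf (φ : ℂ → ℝ) (z : ℂ) : ℝ :=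
  pd1R (pd1R φ) z + pd2R (pd2R φ) z

/-- Components of `(-i∇ - A)u`. -/
noncomputable def mag1 (φ : ℂ → ℝ) (u : ℂ → ℂ) (z : ℂ) : ℂ :=
  -Complex.I * pd1 u z - (A1f φ z : ℂ) * u z

noncomputable def mag2 (φ : ℂ → ℝ) (u : ℂ → ℂ) (z : ℂ) : ℂ :=
  -Complex.I * pd2 u z - (A2f φ z : ℂ) * u z

/-- The polar parametrization `(r, θ) ↦ r e^{iθ}` of the plane. -/
noncomputable def polarMap (p : ℝ × ℝ) : ℂ :=
  p.1 * (Real.cos p.2 + Real.sin p.2 * Complex.I)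

/-- The total derivative of `polarMap`. -/
noncomputable def polarMapDeriv (p : ℝ × ℝ) : ℝ × ℝ →L[ℝ] ℂ :=
  (ContinuousLinearMap.fst ℝ ℝ ℝ).smulRight (Real.cos p.2 + Real.sin p.2 * Complex.I : ℂ) +
    (ContinuousLinearMap.snd ℝ ℝ ℝ).smulRight
      (p.1 * (-Real.sin p.2 + Real.cos p.2 * Complex.I) : ℂ)

lemma hasFDerivAt_polarMap (p : ℝ × ℝ) : HasFDerivAt polarMap (polarMapDeriv p) p := by
  have hcos : HasFDerivAt (fun q : ℝ × ℝ => ((Real.cos q.2 : ℝ) : ℂ)) _ p :=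
    Complex.ofRealCLM.hasFDerivAt.comp p
      ((Real.hasDerivAt_cos p.2).hasFDerivAt.comp p hasFDerivAt_snd)
  have hsin : HasFDerivAt (fun q : ℝ × ℝ => ((Real.sin q.2 : ℝ) : ℂ)) _ p :=
    Complex.ofRealCLM.hasFDerivAt.comp p
      ((Real.hasDerivAt_sin p.2).hasFDerivAt.comp p hasFDerivAt_snd)
  have hr : HasFDerivAt (fun q : ℝ × ℝ => ((q.1 : ℝ) : ℂ)) _ p :=
    Complex.ofRealCLM.hasFDerivAt.comp p hasFDerivAt_fst
  refine (hr.mul (hcos.add (hsin.mul_const Complex.I))).congr_fderiv ?_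
  ext <;> simp [polarMapDeriv]
  ring

lemma continuous_polarMap : Continuous polarMap := by
  unfold polarMap; fun_prop

lemma norm_polarMap (p : ℝ × ℝ) : ‖polarMap p‖ = |p.1| := by
  rw [polarMap, ← Complex.polarCoord_symm_apply, Complex.norm_polarCoord_symm]

lemma clm_apply_eq (D : ℂ →L[ℝ] ℝ) (a b : ℝ) :
    D (a + b * Complex.I) = a * D 1 + b * D Complex.I := by
  have h : (a + b * Complex.I : ℂ) = a • (1 : ℂ) + b • Complex.I := by simp
  rw [h, map_add, map_smul, map_smul, smul_eq_mul, smul_eq_mul]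

/-- Integration over the unit disc in polar coordinates. -/
lemma setIntegral_ball_eq_polar (f : ℂ → ℝ) :
    ∫ z in Metric.ball (0 : ℂ) 1, f z =
      ∫ p in Set.Icc ((0 : ℝ), -Real.pi) (1, Real.pi), p.1 * f (polarMap p) := by
  rw [← integral_indicator Metric.isOpen_ball.measurableSet,
    ← Complex.integral_comp_polarCoord_symm, polarCoord_target,
    setIntegral_eq_of_subset_of_forall_sdiff_eq_zero
      (s := Set.Ioo ((0 : ℝ)) 1 ×ˢ Set.Ioo (-Real.pi) Real.pi)
      (measurableSet_Ioi.prod measurableSet_Ioo)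
      (Set.prod_mono Set.Ioo_subset_Ioi_self subset_rfl)]
  · rw [Set.Icc_prod_eq]
    have hae : (Set.Ioo (0 : ℝ) 1 ×ˢ Set.Ioo (-Real.pi) Real.pi : Set (ℝ × ℝ)) =ᵐ[volume]
        Set.Icc (0 : ℝ) 1 ×ˢ Set.Icc (-Real.pi) Real.pi :=
      Measure.set_prod_ae_eq Ioo_ae_eq_Icc Ioo_ae_eq_Icc
    rw [← setIntegral_congr_set hae]
    refine setIntegral_congr_fun (measurableSet_Ioo.prod measurableSet_Ioo) fun p hp => ?_
    have hp1 := hp.1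
    have hb : polarMap p ∈ Metric.ball (0 : ℂ) 1 := by
      rw [mem_ball_zero_iff, norm_polarMap, abs_of_pos hp1.1]
      exact hp1.2
    simp only [Complex.polarCoord_symm_apply]
    rw [Set.indicator_of_mem (by exact hb)]
    rfl
  · intro p hp
    have hb : polarMap p ∉ Metric.ball (0 : ℂ) 1 := by
      intro h
      rw [mem_ball_zero_iff, norm_polarMap, abs_of_pos hp.1.1] at h
      exact hp.2 ⟨⟨hp.1.1, h⟩, hp.1.2⟩
    simp only [Complex.polarCoord_symm_apply]
    rw [Set.indicator_of_notMem (by exact hb), smul_zero]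

/-- **Green's theorem** on the unit disc. -/
lemma integral_curl_ball (P Q : ℂ → ℝ) (U : Set ℂ) (hU : IsOpen U)
    (hDU : Metric.closedBall (0 : ℂ) 1 ⊆ U) (hP : ContDiffOn ℝ 1 P U) (hQ : ContDiffOn ℝ 1 Q U) :
    ∫ z in Metric.ball (0 : ℂ) 1, (fderiv ℝ Q z 1 - fderiv ℝ P z Complex.I) =
      ∫ θ in (0 : ℝ)..(2 * Real.pi), (-Real.sin θ * P (Complex.exp (Complex.I * θ)) +
        Real.cos θ * Q (Complex.exp (Complex.I * θ))) := by
  have hmem : ∀ p ∈ Set.Icc ((0 : ℝ), -Real.pi) (1, Real.pi), polarMap p ∈ U := by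
    intro p hp
    apply hDU
    rw [mem_closedBall_zero_iff, norm_polarMap, abs_of_nonneg hp.1.1]
    exact hp.2.1
  have hmaps : Set.MapsTo polarMap (Set.Icc ((0 : ℝ), -Real.pi) (1, Real.pi)) U := hmem
  have hd : ∀ {F : ℂ → ℝ}, ContDiffOn ℝ 1 F U → ∀ p, polarMap p ∈ U →
      HasFDerivAt (fun q => F (polarMap q))
        ((fderiv ℝ F (polarMap p)).comp (polarMapDeriv p)) p := fun hF p hp =>
    (((hF.differentiableOn one_ne_zero).differentiableAt
      (hU.mem_nhds hp)).hasFDerivAt).comp p (hasFDerivAt_polarMap p)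
  have hc : ∀ {F : ℂ → ℝ}, ContDiffOn ℝ 1 F U →
      ContinuousOn (fun q => F (polarMap q)) (Set.Icc ((0 : ℝ), -Real.pi) (1, Real.pi)) :=
    fun hF => hF.continuousOn.comp continuous_polarMap.continuousOn hmaps
  have hc' : ∀ {F : ℂ → ℝ}, ContDiffOn ℝ 1 F U → ∀ v : ℂ,
      ContinuousOn (fun q => fderiv ℝ F (polarMap q) v)
        (Set.Icc ((0 : ℝ), -Real.pi) (1, Real.pi)) := fun hF v =>
    ((hF.continuousOn_fderiv_of_isOpen hU le_rfl).comp continuous_polarMap.continuousOn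
      hmaps).clm_apply continuousOn_const
  have hcP := hc hP
  have hcQ := hc hQ
  have hsin : ∀ p : ℝ × ℝ, HasFDerivAt (fun q : ℝ × ℝ => Real.sin q.2)
      (Real.cos p.2 • ContinuousLinearMap.snd ℝ ℝ ℝ) p := fun p =>
    HasFDerivAt.sin hasFDerivAt_snd
  have hcos : ∀ p : ℝ × ℝ, HasFDerivAt (fun q : ℝ × ℝ => Real.cos q.2)
      (-Real.sin p.2 • ContinuousLinearMap.snd ℝ ℝ ℝ) p := fun p =>
    HasFDerivAt.cos hasFDerivAt_snd
  set f : ℝ × ℝ → ℝ := fun p => p.1 * (-Real.sin p.2 * P (polarMap p) +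
    Real.cos p.2 * Q (polarMap p)) with hf
  set g : ℝ × ℝ → ℝ := fun p => -(Real.cos p.2 * P (polarMap p) +
    Real.sin p.2 * Q (polarMap p)) with hg
  have hdf : ∀ p, polarMap p ∈ U → HasFDerivAt f _ p := fun p hp =>
    (hasFDerivAt_fst (𝕜 := ℝ) (p := p)).mul
      (((hsin p).neg.mul (hd hP p hp)).add ((hcos p).mul (hd hQ p hp)))
  have hdg : ∀ p, polarMap p ∈ U → HasFDerivAt g _ p := fun p hp =>
    (((hcos p).mul (hd hP p hp)).add ((hsin p).mul (hd hQ p hp))).neg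
  have hle : ((0 : ℝ), -Real.pi) ≤ (1, Real.pi) :=
    ⟨zero_le_one, by simpa using (neg_le_self Real.pi_pos.le)⟩
  have hexp : ∀ θ : ℝ, polarMap (1, θ) = Complex.exp (Complex.I * θ) := fun θ => by
    rw [mul_comm, Complex.exp_mul_I]
    simp [polarMap]
  have hg0 : ∀ r, g (r, Real.pi) = g (r, -Real.pi) := fun r => by
    simp [hg, polarMap]
  have hdiv : ∀ p ∈ Set.Icc ((0 : ℝ), -Real.pi) (1, Real.pi),
      fderiv ℝ f p (1, 0) + fderiv ℝ g p (0, 1) =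
      p.1 * (fderiv ℝ Q (polarMap p) 1 - fderiv ℝ P (polarMap p) Complex.I) := fun p hp => by
    have e1 : polarMapDeriv p (1, 0) = (Real.cos p.2 : ℝ) + (Real.sin p.2 : ℝ) * Complex.I := by
      simp [polarMapDeriv]
    have e2 : polarMapDeriv p (0, 1) = ((-(p.1 * Real.sin p.2) : ℝ) : ℂ) +
        ((p.1 * Real.cos p.2 : ℝ) : ℂ) * Complex.I := by
      simp [polarMapDeriv]
      ring
    rw [(hdf p (hmem p hp)).fderiv, (hdg p (hmem p hp)).fderiv]
    simp only [add_apply, neg_apply, smul_apply, ContinuousLinearMap.comp_apply, e1, e2, clm_apply_eq,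
      ContinuousLinearMap.coe_fst', ContinuousLinearMap.coe_snd', Pi.neg_apply, smul_eq_mul]
    linear_combination (p.1 * (fderiv ℝ Q (polarMap p) 1 - fderiv ℝ P (polarMap p) Complex.I)) *
      Real.sin_sq_add_cos_sq p.2
  have hdivc : ContinuousOn (fun p : ℝ × ℝ => fderiv ℝ f p (1, 0) + fderiv ℝ g p (0, 1))
      (Set.Icc ((0 : ℝ), -Real.pi) (1, Real.pi)) :=
    (continuousOn_fst.mul ((hc' hQ 1).sub (hc' hP Complex.I))).congr hdiv
  have hcsin : ContinuousOn (fun p : ℝ × ℝ => Real.sin p.2)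
      (Set.Icc ((0 : ℝ), -Real.pi) (1, Real.pi)) :=
    (Real.continuous_sin.comp continuous_snd).continuousOn
  have hccos : ContinuousOn (fun p : ℝ × ℝ => Real.cos p.2)
      (Set.Icc ((0 : ℝ), -Real.pi) (1, Real.pi)) :=
    (Real.continuous_cos.comp continuous_snd).continuousOn
  have hfc : ContinuousOn f (Set.Icc ((0 : ℝ), -Real.pi) (1, Real.pi)) :=
    continuousOn_fst.mul ((hcsin.neg.mul hcP).add (hccos.mul hcQ))
  have hgc : ContinuousOn g (Set.Icc ((0 : ℝ), -Real.pi) (1, Real.pi)) :=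
    ((hccos.mul hcP).add (hcsin.mul hcQ)).neg
  have key := integral_divergence_prod_Icc_of_hasFDerivAt_off_countable_of_le f g
    (fderiv ℝ f) (fderiv ℝ g) _ _ hle ∅ Set.countable_empty hfc hgc
    (fun p hp => (hdf p (hmem p ⟨⟨hp.1.1.1.le, hp.1.2.1.le⟩,
      ⟨hp.1.1.2.le, hp.1.2.2.le⟩⟩)).differentiableAt.hasFDerivAt)
    (fun p hp => (hdg p (hmem p ⟨⟨hp.1.1.1.le, hp.1.2.1.le⟩,
      ⟨hp.1.1.2.le, hp.1.2.2.le⟩⟩)).differentiableAt.hasFDerivAt)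
    (hdivc.integrableOn_compact isCompact_Icc)
  rw [setIntegral_ball_eq_polar, ← setIntegral_congr_fun measurableSet_Icc hdiv, key]
  simp only [hg0, sub_self, zero_add, hf, zero_mul, intervalIntegral.integral_zero, sub_zero,
    one_mul, hexp]
  have hper : Function.Periodic (fun θ : ℝ => -Real.sin θ * P (Complex.exp (Complex.I * θ)) +
      Real.cos θ * Q (Complex.exp (Complex.I * θ))) (2 * Real.pi) := fun θ => by
    have : Complex.exp (Complex.I * ((θ + 2 * Real.pi : ℝ) : ℂ)) =
        Complex.exp (Complex.I * θ) := by
      rw [← Complex.exp_periodic (Complex.I * θ)]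
      congr 1
      push_cast
      ring
    simp only [this, Real.sin_add_two_pi, Real.cos_add_two_pi]
  have := hper.intervalIntegral_add_eq (-Real.pi) 0
  rwa [zero_add, show -Real.pi + 2 * Real.pi = Real.pi by ring] at this

lemma contDiffOn_fderiv_apply {E : Type*} [NormedAddCommGroup E] [NormedSpace ℝ E]
    {f : ℂ → E} {U : Set ℂ} (hU : IsOpen U) (hf : ContDiffOn ℝ (⊤ : ℕ∞) f U) (v : ℂ) :
    ContDiffOn ℝ (⊤ : ℕ∞) (fun z => fderiv ℝ f z v) U :=
  (hf.fderiv_of_isOpen hU (by simp)).clm_apply contDiffOn_const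

lemma re_conj_mul_mag1 (φ : ℂ → ℝ) (u : ℂ → ℂ) (z : ℂ) :
    (starRingEnd ℂ (u z) * mag1 φ u z).re =
      (u z).re * (pd1 u z).im - (u z).im * (pd1 u z).re +
        pd2R φ z * ((u z).re ^ 2 + (u z).im ^ 2) := by
  simp [mag1, A1f]
  ring

lemma re_conj_mul_mag2 (φ : ℂ → ℝ) (u : ℂ → ℂ) (z : ℂ) :
    (starRingEnd ℂ (u z) * mag2 φ u z).re =
      (u z).re * (pd2 u z).im - (u z).im * (pd2 u z).re -
        pd1R φ z * ((u z).re ^ 2 + (u z).im ^ 2) := by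
  simp [mag2, A2f]
  ring

/-- Directional derivative of the density `Im (ū w) + a |u|²`. -/
lemma fderiv_current {u w : ℂ → ℂ} {a : ℂ → ℝ} {z : ℂ} (hu : DifferentiableAt ℝ u z)
    (hw : DifferentiableAt ℝ w z) (ha : DifferentiableAt ℝ a z) (v : ℂ) :
    fderiv ℝ (fun z => (u z).re * (w z).im - (u z).im * (w z).re +
        a z * ((u z).re ^ 2 + (u z).im ^ 2)) z v =
      (fderiv ℝ u z v).re * (w z).im + (u z).re * (fderiv ℝ w z v).im -
        (fderiv ℝ u z v).im * (w z).re - (u z).im * (fderiv ℝ w z v).re +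
        fderiv ℝ a z v * ((u z).re ^ 2 + (u z).im ^ 2) +
        a z * (2 * (u z).re * (fderiv ℝ u z v).re + 2 * (u z).im * (fderiv ℝ u z v).im) := by
  have hur : HasFDerivAt (fun z => (u z).re) _ z :=
    Complex.reCLM.hasFDerivAt.comp z hu.hasFDerivAt
  have hui : HasFDerivAt (fun z => (u z).im) _ z :=
    Complex.imCLM.hasFDerivAt.comp z hu.hasFDerivAt
  have hwr : HasFDerivAt (fun z => (w z).re) _ z :=
    Complex.reCLM.hasFDerivAt.comp z hw.hasFDerivAt
  have hwi : HasFDerivAt (fun z => (w z).im) _ z :=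
    Complex.imCLM.hasFDerivAt.comp z hw.hasFDerivAt
  have h := ((hur.mul hwi).sub (hui.mul hwr)).add
    (ha.hasFDerivAt.mul ((hur.pow 2).add (hui.pow 2)))
  refine (congrArg (fun L => L v) h.fderiv).trans ?_
  simp
  ring

/-- Pointwise form of the identity: the difference of the two energy densities is a curl. -/
lemma energy_density_sub_eq_curl {φ : ℂ → ℝ} {u : ℂ → ℂ} {z : ℂ}
    (hφ : ContDiffAt ℝ (⊤ : ℕ∞) φ z) (hu : ContDiffAt ℝ (⊤ : ℕ∞) u z) :
    (‖mag1 φ u z‖ ^ 2 + ‖mag2 φ u z‖ ^ 2 - Bf φ z * ‖u z‖ ^ 2) -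
      4 * ‖(pd1 u z + Complex.I * pd2 u z) / 2
          + (((pd1R φ z : ℂ) + Complex.I * (pd2R φ z : ℂ)) / 2) * u z‖ ^ 2 =
    fderiv ℝ (fun z => (starRingEnd ℂ (u z) * mag2 φ u z).re) z 1 -
      fderiv ℝ (fun z => (starRingEnd ℂ (u z) * mag1 φ u z).re) z Complex.I := by
  have htwo : (2 : WithTop ℕ∞) ≤ ((⊤ : ℕ∞) : WithTop ℕ∞) :=
    WithTop.coe_le_coe.2 (le_top : (2 : ℕ∞) ≤ ⊤)
  have hu' : DifferentiableAt ℝ (fderiv ℝ u) z :=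
    (hu.fderiv_right (m := 1) (by rwa [one_add_one_eq_two])).differentiableAt one_ne_zero
  have hφ' : DifferentiableAt ℝ (fderiv ℝ φ) z :=
    (hφ.fderiv_right (m := 1) (by rwa [one_add_one_eq_two])).differentiableAt one_ne_zero
  have hdu : DifferentiableAt ℝ u z := hu.differentiableAt (by simp)
  have hpd : ∀ v : ℂ, DifferentiableAt ℝ (fun z => fderiv ℝ u z v) z := fun v =>
    hu'.clm_apply (differentiableAt_const v)
  have hpdR : ∀ v : ℂ, DifferentiableAt ℝ (fun z => fderiv ℝ φ z v) z := fun v =>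
    hφ'.clm_apply (differentiableAt_const v)
  have hsymm : fderiv ℝ (pd2 u) z 1 = fderiv ℝ (pd1 u) z Complex.I := by
    have h := hu.isSymmSndFDerivAt (by simpa using htwo) 1 Complex.I
    have e : ∀ v w : ℂ, fderiv ℝ (fun z => fderiv ℝ u z v) z w = fderiv ℝ (fderiv ℝ u) z w v :=
      fun v w => by
        rw [fderiv_clm_apply hu' (differentiableAt_const v)]
        simp
    exact (e _ _).trans (h.trans (e _ _).symm)
  have h2 := fderiv_current hdu (hpd Complex.I) (hpdR 1).neg 1
  have h1 := fderiv_current hdu (hpd 1) (hpdR Complex.I) Complex.I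
  have hneg : fderiv ℝ (-fun z => fderiv ℝ φ z 1) z 1 = - pd1R (pd1R φ) z := by
    rw [fderiv_neg]; rfl
  simp only [re_conj_mul_mag1, re_conj_mul_mag2, sub_eq_add_neg (_ - _) (_ * _), ← neg_mul]
  refine Eq.trans ?_ (congrArg₂ (· - ·) h2 h1).symm
  change _ = _ + _ + _ - (_ + pd2R (pd2R φ) z * _ + _)
  rw [hneg]
  change fderiv ℝ (fun z => fderiv ℝ u z Complex.I) z 1 =
    fderiv ℝ (fun z => fderiv ℝ u z 1) z Complex.I at hsymm
  rw [hsymm]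
  simp only [← Complex.normSq_eq_norm_sq, Complex.normSq_apply, mag1, mag2, A1f, A2f, Bf, pd1, pd2,
    Pi.neg_apply]
  rw [show fderiv ℝ φ z 1 = pd1R φ z from rfl, show fderiv ℝ φ z Complex.I = pd2R φ z from rfl]
  simp
  ring

/-- Integration-by-parts identity for the Robin quadratic form on the unit disc:
`∫_D (|(-i∇-A)u|² - B|u|²) + ∫_Γ g|u|² = 4∫_D |∂_z̄ u + (∂_z̄ φ)u|² + ∫_Γ (g|u|² + τ·j_A(u))`. -/
theorem stmt_6 (φ : ℂ → ℝ) (U : Set ℂ) (hU : IsOpen U)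
    (hDU : Metric.closedBall (0:ℂ) 1 ⊆ U) (hφ : ContDiffOn ℝ (⊤ : ℕ∞) φ U)
    (hφ0 : ∀ z : ℂ, ‖z‖ = 1 → φ z = 0)
    (g : ℝ → ℝ) (hg : Continuous g) (hgper : ∀ θ, g (θ + 2 * Real.pi) = g θ)
    (u : ℂ → ℂ) (hu : ContDiffOn ℝ (⊤ : ℕ∞) u U) :
    (∫ z in Metric.ball (0:ℂ) 1,
        (‖mag1 φ u z‖ ^ 2 + ‖mag2 φ u z‖ ^ 2 - Bf φ z * ‖u z‖ ^ 2))
      + (∫ θ in (0:ℝ)..(2 * Real.pi), g θ * ‖u (Complex.exp (Complex.I * θ))‖ ^ 2)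
    =
    4 * (∫ z in Metric.ball (0:ℂ) 1,
        ‖(pd1 u z + Complex.I * pd2 u z) / 2
          + (((pd1R φ z : ℂ) + Complex.I * (pd2R φ z : ℂ)) / 2) * u z‖ ^ 2)
      + ∫ θ in (0:ℝ)..(2 * Real.pi),
          (g θ * ‖u (Complex.exp (Complex.I * θ))‖ ^ 2
            + ((starRingEnd ℂ) (u (Complex.exp (Complex.I * θ))) *
                (((-Real.sin θ : ℝ) : ℂ) * mag1 φ u (Complex.exp (Complex.I * θ))
                  + ((Real.cos θ : ℝ) : ℂ) * mag2 φ u (Complex.exp (Complex.I * θ)))).re) := by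
  have hnhds : ∀ z ∈ Metric.closedBall (0 : ℂ) 1, U ∈ nhds z := fun z hz =>
    hU.mem_nhds (hDU hz)
  have hu1 : ContDiffOn ℝ (⊤ : ℕ∞) (pd1 u) U := contDiffOn_fderiv_apply hU hu 1
  have hu2 : ContDiffOn ℝ (⊤ : ℕ∞) (pd2 u) U := contDiffOn_fderiv_apply hU hu Complex.I
  have hφ1 : ContDiffOn ℝ (⊤ : ℕ∞) (pd1R φ) U := contDiffOn_fderiv_apply hU hφ 1
  have hφ2 : ContDiffOn ℝ (⊤ : ℕ∞) (pd2R φ) U := contDiffOn_fderiv_apply hU hφ Complex.I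
  have hφ11 : ContDiffOn ℝ (⊤ : ℕ∞) (pd1R (pd1R φ)) U := contDiffOn_fderiv_apply hU hφ1 1
  have hφ22 : ContDiffOn ℝ (⊤ : ℕ∞) (pd2R (pd2R φ)) U :=
    contDiffOn_fderiv_apply hU hφ2 Complex.I
  have hofReal : ∀ {a : ℂ → ℝ}, ContDiffOn ℝ (⊤ : ℕ∞) a U →
      ContDiffOn ℝ (⊤ : ℕ∞) (fun z => (a z : ℂ)) U := fun ha =>
    Complex.ofRealCLM.contDiff.comp_contDiffOn ha
  have hm1 : ContDiffOn ℝ (⊤ : ℕ∞) (mag1 φ u) U :=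
    (contDiffOn_const.mul hu1).sub ((hofReal hφ2.neg).mul hu)
  have hm2 : ContDiffOn ℝ (⊤ : ℕ∞) (mag2 φ u) U :=
    (contDiffOn_const.mul hu2).sub ((hofReal hφ1).mul hu)
  have hcurrent : ∀ {w : ℂ → ℂ}, ContDiffOn ℝ (⊤ : ℕ∞) w U →
      ContDiffOn ℝ (⊤ : ℕ∞) (fun z => (starRingEnd ℂ (u z) * w z).re) U := fun hw =>
    Complex.reCLM.contDiff.comp_contDiffOn
      ((Complex.conjCLE.contDiff.comp_contDiffOn hu).mul hw)
  have hgreen := integral_curl_ball _ _ U hU hDU ((hcurrent hm1).of_le (by exact_mod_cast le_top))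
    ((hcurrent hm2).of_le (by exact_mod_cast le_top))
  have hint : ∀ {F : ℂ → ℝ}, ContinuousOn F U → IntegrableOn F (Metric.ball 0 1) := fun hF =>
    ((hF.mono hDU).integrableOn_compact (isCompact_closedBall _ _)).mono_set
      Metric.ball_subset_closedBall
  have hint1 := hint (F := fun z => ‖mag1 φ u z‖ ^ 2 + ‖mag2 φ u z‖ ^ 2 - Bf φ z * ‖u z‖ ^ 2)
    (((hm1.continuousOn.norm.pow 2).add (hm2.continuousOn.norm.pow 2)).sub
      ((hφ11.continuousOn.add hφ22.continuousOn).mul (hu.continuousOn.norm.pow 2)))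
  have hint2 := hint (F := fun z => ‖(pd1 u z + Complex.I * pd2 u z) / 2
      + (((pd1R φ z : ℂ) + Complex.I * (pd2R φ z : ℂ)) / 2) * u z‖ ^ 2) (by
    have h1 := hu1.continuousOn
    have h2 := hu2.continuousOn
    have h3 := (hofReal hφ1).continuousOn
    have h4 := (hofReal hφ2).continuousOn
    have h5 := hu.continuousOn
    fun_prop)
  rw [← setIntegral_congr_fun Metric.isOpen_ball.measurableSet (fun z hz =>
      energy_density_sub_eq_curl (hφ.contDiffAt (hnhds z (Metric.ball_subset_closedBall hz)))
        (hu.contDiffAt (hnhds z (Metric.ball_subset_closedBall hz)))),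
    integral_sub hint1 (hint2.const_mul 4), integral_const_mul] at hgreen
  have hcirc : ∀ {E : Type} [TopologicalSpace E] {F : ℂ → E}, ContinuousOn F U →
      Continuous (fun θ : ℝ => F (Complex.exp (Complex.I * θ))) := fun hF =>
    hF.comp_continuous (by fun_prop) fun θ => hDU (by
      rw [mem_closedBall_zero_iff, mul_comm, Complex.norm_exp_ofReal_mul_I])
  have hcu := hcirc hu.continuousOn
  have hc1 := hcirc (hcurrent hm1).continuousOn
  have hc2 := hcirc (hcurrent hm2).continuousOn
  have hsplit : ∀ θ : ℝ, ((starRingEnd ℂ) (u (Complex.exp (Complex.I * θ))) *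
      (((-Real.sin θ : ℝ) : ℂ) * mag1 φ u (Complex.exp (Complex.I * θ))
        + ((Real.cos θ : ℝ) : ℂ) * mag2 φ u (Complex.exp (Complex.I * θ)))).re =
      -Real.sin θ * (starRingEnd ℂ (u (Complex.exp (Complex.I * θ))) *
        mag1 φ u (Complex.exp (Complex.I * θ))).re +
      Real.cos θ * (starRingEnd ℂ (u (Complex.exp (Complex.I * θ))) *
        mag2 φ u (Complex.exp (Complex.I * θ))).re := fun θ => by
    rw [mul_add, mul_left_comm, mul_left_comm (starRingEnd ℂ _), Complex.add_re,
      Complex.re_ofReal_mul, Complex.re_ofReal_mul]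
  simp only [hsplit]
  have hi1 : IntervalIntegrable (fun θ => g θ * ‖u (Complex.exp (Complex.I * θ))‖ ^ 2) volume
      0 (2 * Real.pi) := (hg.mul (hcu.norm.pow 2)).intervalIntegrable _ _
  have hi2 : IntervalIntegrable (fun θ : ℝ =>
      -Real.sin θ * (starRingEnd ℂ (u (Complex.exp (Complex.I * θ))) *
        mag1 φ u (Complex.exp (Complex.I * θ))).re +
      Real.cos θ * (starRingEnd ℂ (u (Complex.exp (Complex.I * θ))) *
        mag2 φ u (Complex.exp (Complex.I * θ))).re) volume 0 (2 * Real.pi) :=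
    ((Real.continuous_sin.neg.mul hc1).add (Real.continuous_cos.mul hc2)).intervalIntegrable _ _
  rw [intervalIntegral.integral_add hi1 hi2]
  linarith
end

section
/- Let g : ℝ → ℝ be continuous and 2π-periodic, and let w be holomorphic on an open neighbourhood of the closed unit disc. Set u = e^{−φ} w and p(θ) = w(e^{iθ}). Then ∫_D ( |(−i∇ − A)u|² − B |u|² ) dx + ∫_0^{2π} g(θ) |p(θ)|² dθ = Re ∫_0^{2π} ( −i p′(θ) − A_τ(θ) p(θ) + g(θ) p(θ) ) · conj(p(θ)) dθ, where A_τ(θ) = τ(e^{iθ}) · A(e^{iθ}) is the tangential component of A on the unit circle. -/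
open MeasureTheory

/-- The tangential component `A_τ(θ) = τ(e^{iθ}) · A(e^{iθ})` with `τ = (-sin θ, cos θ)`. -/
noncomputable def Atan (φ : ℂ → ℝ) (θ : ℝ) : ℝ :=
  -Real.sin θ * A1f φ (Complex.exp (Complex.I * θ))
    + Real.cos θ * A2f φ (Complex.exp (Complex.I * θ))

/-- The first component of half the gradient of `exp (-2φ)|w|²`, for holomorphic `w`. -/
noncomputable def halfGrad1 (φ : ℂ → ℝ) (w : ℂ → ℂ) (z : ℂ) : ℝ :=
  Real.exp (-2 * φ z) * ((w z).re * (deriv w z).re + (w z).im * (deriv w z).im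
    - pd1R φ z * ((w z).re ^ 2 + (w z).im ^ 2))

/-- The second component of half the gradient of `exp (-2φ)|w|²`, for holomorphic `w`. -/
noncomputable def halfGrad2 (φ : ℂ → ℝ) (w : ℂ → ℂ) (z : ℂ) : ℝ :=
  Real.exp (-2 * φ z) * ((w z).im * (deriv w z).re - (w z).re * (deriv w z).im
    - pd2R φ z * ((w z).re ^ 2 + (w z).im ^ 2))

/-- The divergence theorem on the unit disc. -/
theorem integral_ball_divergence (V W : ℂ → ℝ) (U : Set ℂ) (hU : IsOpen U)
    (hDU : Metric.closedBall (0 : ℂ) 1 ⊆ U) (hV : ContDiffOn ℝ 1 V U) (hW : ContDiffOn ℝ 1 W U) :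
    ∫ z in Metric.ball (0 : ℂ) 1, (pd1R V z + pd2R W z) =
      ∫ θ in (0 : ℝ)..(2 * Real.pi), (Real.cos θ * V (Complex.exp (Complex.I * θ))
        + Real.sin θ * W (Complex.exp (Complex.I * θ))) := by
  set e : ℝ × ℝ → ℂ := fun x => (x.1 : ℂ) * Complex.exp (Complex.I * x.2) with he
  have hec : Continuous e := by fun_prop
  have hpol (x : ℝ × ℝ) : Complex.polarCoord.symm x = e x := by
    rw [Complex.polarCoord_symm_apply, he]
    simp only [mul_comm Complex.I, Complex.exp_mul_I]
    push_cast
    ring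
  have hnorm (x : ℝ × ℝ) : ‖e x‖ = |x.1| := by
    simp [he, mul_comm Complex.I, Complex.norm_exp_ofReal_mul_I]
  have hed (x : ℝ × ℝ) : HasFDerivAt e
      ((Complex.exp (Complex.I * x.2)) • (Complex.ofRealCLM.comp (ContinuousLinearMap.fst ℝ ℝ ℝ)) +
        ((x.1 : ℂ) * (Complex.exp (Complex.I * x.2) * Complex.I)) •
          (Complex.ofRealCLM.comp (ContinuousLinearMap.snd ℝ ℝ ℝ))) x := by
    have h1 : HasFDerivAt (fun x : ℝ × ℝ => (x.1 : ℂ))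
        (Complex.ofRealCLM.comp (ContinuousLinearMap.fst ℝ ℝ ℝ)) x :=
      (Complex.ofRealCLM.comp (ContinuousLinearMap.fst ℝ ℝ ℝ)).hasFDerivAt
    have h2 : HasFDerivAt (fun x : ℝ × ℝ => (x.2 : ℂ))
        (Complex.ofRealCLM.comp (ContinuousLinearMap.snd ℝ ℝ ℝ)) x :=
      (Complex.ofRealCLM.comp (ContinuousLinearMap.snd ℝ ℝ ℝ)).hasFDerivAt
    have h3 := h1.mul ((h2.const_mul Complex.I).cexp)
    refine h3.congr_fderiv ?_
    ext <;> simp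
  have hmaps : Set.MapsTo e (Set.Icc ((0 : ℝ), -Real.pi) (1, Real.pi)) U := by
    intro x hx
    apply hDU
    rw [mem_closedBall_zero_iff, hnorm, abs_of_nonneg hx.1.1]
    exact hx.2.1
  have hVe : ContinuousOn (fun x => V (e x)) (Set.Icc ((0 : ℝ), -Real.pi) (1, Real.pi)) :=
    hV.continuousOn.comp hec.continuousOn hmaps
  have hWe : ContinuousOn (fun x => W (e x)) (Set.Icc ((0 : ℝ), -Real.pi) (1, Real.pi)) :=
    hW.continuousOn.comp hec.continuousOn hmaps
  have hdiv : ContinuousOn (fun z => pd1R V z + pd2R W z) U := by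
    have h1 := hV.continuousOn_fderiv_of_isOpen hU le_rfl
    have h2 := hW.continuousOn_fderiv_of_isOpen hU le_rfl
    exact (h1.clm_apply continuousOn_const).add (h2.clm_apply continuousOn_const)
  have hVd (x) (hx : x ∈ Set.Icc ((0 : ℝ), -Real.pi) (1, Real.pi)) :=
    (((hV.differentiableOn one_ne_zero).differentiableAt
      (hU.mem_nhds (hmaps hx))).hasFDerivAt.comp x (hed x))
  have hWd (x) (hx : x ∈ Set.Icc ((0 : ℝ), -Real.pi) (1, Real.pi)) :=
    (((hW.differentiableOn one_ne_zero).differentiableAt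
      (hU.mem_nhds (hmaps hx))).hasFDerivAt.comp x (hed x))
  have hcos (x : ℝ × ℝ) := (ContinuousLinearMap.snd ℝ ℝ ℝ).hasFDerivAt (x := x).cos
  have hsin (x : ℝ × ℝ) := (ContinuousLinearMap.snd ℝ ℝ ℝ).hasFDerivAt (x := x).sin
  have hfst (x : ℝ × ℝ) := (ContinuousLinearMap.fst ℝ ℝ ℝ).hasFDerivAt (x := x)
  have hIoo : ∀ x ∈ Set.Ioo (0 : ℝ) 1 ×ˢ Set.Ioo (-Real.pi) Real.pi,
      x ∈ Set.Icc ((0 : ℝ), -Real.pi) (1, Real.pi) := fun x hx =>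
    ⟨⟨hx.1.1.le, hx.2.1.le⟩, ⟨hx.1.2.le, hx.2.2.le⟩⟩
  set f : ℝ × ℝ → ℝ := fun x => x.1 * (Real.cos x.2 * V (e x) + Real.sin x.2 * W (e x)) with hf
  set h : ℝ × ℝ → ℝ := fun x => Real.cos x.2 * W (e x) - Real.sin x.2 * V (e x) with hh
  have hfd (x) (hx : x ∈ Set.Icc ((0 : ℝ), -Real.pi) (1, Real.pi)) :=
    (hfst x).mul (((hcos x).mul (hVd x hx)).add ((hsin x).mul (hWd x hx)))
  have hhd (x) (hx : x ∈ Set.Icc ((0 : ℝ), -Real.pi) (1, Real.pi)) :=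
    ((hcos x).mul (hWd x hx)).sub ((hsin x).mul (hVd x hx))
  have hfun (L : ℂ →L[ℝ] ℝ) (c : ℂ) : L c = c.re * L 1 + c.im * L Complex.I := by
    conv_lhs => rw [← Complex.re_add_im c, map_add, ← mul_one (c.re : ℂ)]
    rw [← Complex.real_smul, ← Complex.real_smul, map_smul, map_smul, smul_eq_mul, smul_eq_mul]
  have hsum (x) (hx : x ∈ Set.Icc ((0 : ℝ), -Real.pi) (1, Real.pi)) :
      fderiv ℝ f x (1, 0) + fderiv ℝ h x (0, 1) = x.1 * (pd1R V (e x) + pd2R W (e x)) := by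
    have h1 : fderiv ℝ f x = _ := (hfd x hx).fderiv
    have h2 : fderiv ℝ h x = _ := (hhd x hx).fderiv
    rw [h1, h2]
    simp [hfun (fderiv ℝ V (e x)) (Complex.exp _), hfun (fderiv ℝ W (e x)) (Complex.exp _),
      hfun (fderiv ℝ V (e x)) (_ * _), hfun (fderiv ℝ W (e x)) (_ * _), mul_comm Complex.I,
      Complex.exp_ofReal_mul_I_re, Complex.exp_ofReal_mul_I_im, pd1R, pd2R]
    linear_combination x.1 * (fderiv ℝ V (e x) 1 + fderiv ℝ W (e x) Complex.I) *
      Real.sin_sq_add_cos_sq x.2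
  have hcosc : ContinuousOn (fun x : ℝ × ℝ => Real.cos x.2)
      (Set.Icc ((0 : ℝ), -Real.pi) (1, Real.pi)) := by fun_prop
  have hsinc : ContinuousOn (fun x : ℝ × ℝ => Real.sin x.2)
      (Set.Icc ((0 : ℝ), -Real.pi) (1, Real.pi)) := by fun_prop
  have key := integral_divergence_prod_Icc_of_hasFDerivAt_of_le f h (fderiv ℝ f) (fderiv ℝ h)
    ((0 : ℝ), -Real.pi) (1, Real.pi) ⟨zero_le_one, by simp; linarith [Real.pi_pos]⟩
    (continuousOn_fst.mul ((hcosc.mul hVe).add (hsinc.mul hWe)))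
    ((hcosc.mul hWe).sub (hsinc.mul hVe))
    (fun x hx => (hfd x (hIoo x hx)).differentiableAt.hasFDerivAt)
    (fun x hx => (hhd x (hIoo x hx)).differentiableAt.hasFDerivAt)
    (ContinuousOn.integrableOn_compact isCompact_Icc
      ((continuousOn_fst.mul (hdiv.comp hec.continuousOn hmaps)).congr hsum))
  rw [setIntegral_congr_fun measurableSet_Icc hsum] at key
  have hper : Function.Periodic (fun θ : ℝ => Real.cos θ * V (Complex.exp (Complex.I * θ))
        + Real.sin θ * W (Complex.exp (Complex.I * θ))) (2 * Real.pi) := by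
    intro θ
    have : Complex.exp (Complex.I * ((θ + 2 * Real.pi : ℝ) : ℂ)) = Complex.exp (Complex.I * θ) := by
      rw [← Complex.exp_periodic (Complex.I * θ)]
      congr 1
      push_cast
      ring
    simp only [this, Real.cos_add_two_pi, Real.sin_add_two_pi]
  have hshift := hper.intervalIntegral_add_eq (-Real.pi) 0
  rw [show -Real.pi + 2 * Real.pi = Real.pi by ring, zero_add] at hshift
  have hpi : ∀ r : ℝ, e (r, Real.pi) = e (r, -Real.pi) := by
    intro r
    simp [he, mul_comm Complex.I, Complex.exp_neg]
  have hbd : ∀ r : ℝ, h (r, Real.pi) = h (r, -Real.pi) := by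
    intro r
    simp [hh, hpi]
  have hone : ∀ θ : ℝ, f (1, θ) = Real.cos θ * V (Complex.exp (Complex.I * θ))
        + Real.sin θ * W (Complex.exp (Complex.I * θ)) := by simp [hf, he]
  have hzero : ∀ θ : ℝ, f (0, θ) = 0 := by simp [hf]
  simp only [hbd, hone, hzero, sub_self, zero_add, intervalIntegral.integral_zero, sub_zero] at key
  have hind : ∀ x ∈ polarCoord.target,
      x.1 • (Metric.ball (0 : ℂ) 1).indicator (fun z => pd1R V z + pd2R W z)
        (Complex.polarCoord.symm x) =
      (Set.Ioo (0 : ℝ) 1 ×ˢ Set.Ioo (-Real.pi) Real.pi).indicator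
        (fun x => x.1 * (pd1R V (e x) + pd2R W (e x))) x := by
    intro x hx
    have hx1 : 0 < x.1 := hx.1
    have hx2 : x.2 ∈ Set.Ioo (-Real.pi) Real.pi := hx.2
    rw [hpol]
    by_cases hlt : x.1 < 1
    · have hmem : x ∈ Set.Ioo (0 : ℝ) 1 ×ˢ Set.Ioo (-Real.pi) Real.pi := ⟨⟨hx1, hlt⟩, hx2⟩
      rw [Set.indicator_of_mem (by rwa [mem_ball_zero_iff, hnorm, abs_of_pos hx1]),
        Set.indicator_of_mem hmem, smul_eq_mul]
    · rw [Set.indicator_of_notMem (by rwa [mem_ball_zero_iff, hnorm, abs_of_pos hx1]),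
        Set.indicator_of_notMem (fun hmem => hlt (Set.mem_prod.1 hmem).1.2), smul_zero]
  have hsub : polarCoord.target ∩ Set.Ioo (0 : ℝ) 1 ×ˢ Set.Ioo (-Real.pi) Real.pi =
      Set.Ioo (0 : ℝ) 1 ×ˢ Set.Ioo (-Real.pi) Real.pi :=
    Set.inter_eq_right.2 (Set.prod_mono (fun _ h => h.1) subset_rfl)
  have hae : (Set.Ioo (0 : ℝ) 1 ×ˢ Set.Ioo (-Real.pi) Real.pi : Set (ℝ × ℝ)) =ᵐ[volume]
      Set.Icc ((0 : ℝ), -Real.pi) (1, Real.pi) := by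
    rw [← Set.Icc_prod_Icc]
    exact Measure.set_prod_ae_eq Ioo_ae_eq_Icc Ioo_ae_eq_Icc
  rw [← hshift, ← key, ← integral_indicator measurableSet_ball,
    ← Complex.integral_comp_polarCoord_symm,
    setIntegral_congr_fun polarCoord.open_target.measurableSet hind,
    setIntegral_indicator (measurableSet_Ioo.prod measurableSet_Ioo), hsub,
    setIntegral_congr_set hae]

theorem hasFDerivAt_re_of_differentiableAt {f : ℂ → ℂ} {z : ℂ} (hf : DifferentiableAt ℂ f z) :
    HasFDerivAt (fun z => (f z).re)
      ((deriv f z).re • Complex.reCLM - (deriv f z).im • Complex.imCLM) z := by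
  refine (Complex.reCLM.hasFDerivAt.comp z
    (hf.hasDerivAt.hasFDerivAt.restrictScalars ℝ)).congr_fderiv ?_
  ext v
  simp
  ring

theorem hasFDerivAt_im_of_differentiableAt {f : ℂ → ℂ} {z : ℂ} (hf : DifferentiableAt ℂ f z) :
    HasFDerivAt (fun z => (f z).im)
      ((deriv f z).im • Complex.reCLM + (deriv f z).re • Complex.imCLM) z := by
  refine (Complex.imCLM.hasFDerivAt.comp z
    (hf.hasDerivAt.hasFDerivAt.restrictScalars ℝ)).congr_fderiv ?_
  ext v
  simp
  ring

theorem contDiffOn_pd1R {φ : ℂ → ℝ} {U : Set ℂ} (hU : IsOpen U)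
    (hφ : ContDiffOn ℝ (⊤ : ℕ∞) φ U) : ContDiffOn ℝ 1 (pd1R φ) U :=
  (hφ.fderiv_of_isOpen hU (m := 1) (by norm_cast)).clm_apply contDiffOn_const

theorem contDiffOn_pd2R {φ : ℂ → ℝ} {U : Set ℂ} (hU : IsOpen U)
    (hφ : ContDiffOn ℝ (⊤ : ℕ∞) φ U) : ContDiffOn ℝ 1 (pd2R φ) U :=
  (hφ.fderiv_of_isOpen hU (m := 1) (by norm_cast)).clm_apply contDiffOn_const

theorem contDiffOn_re_im {f : ℂ → ℂ} {U : Set ℂ} (hU : IsOpen U)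
    (hf : DifferentiableOn ℂ f U) :
    ContDiffOn ℝ 1 (fun z => (f z).re) U ∧ ContDiffOn ℝ 1 (fun z => (f z).im) U :=
  have h : ContDiffOn ℝ 1 f U := (hf.contDiffOn hU).restrict_scalars ℝ
  ⟨Complex.reCLM.contDiff.comp_contDiffOn h, Complex.imCLM.contDiff.comp_contDiffOn h⟩

theorem contDiffOn_halfGrad {φ : ℂ → ℝ} {w : ℂ → ℂ} {U : Set ℂ} (hU : IsOpen U)
    (hφ : ContDiffOn ℝ (⊤ : ℕ∞) φ U) (hw : DifferentiableOn ℂ w U) :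
    ContDiffOn ℝ 1 (halfGrad1 φ w) U ∧ ContDiffOn ℝ 1 (halfGrad2 φ w) U := by
  obtain ⟨ha, hb⟩ := contDiffOn_re_im hU hw
  obtain ⟨hc, hd⟩ := contDiffOn_re_im hU (hw.deriv hU)
  have h1 := contDiffOn_pd1R hU hφ
  have h2 := contDiffOn_pd2R hU hφ
  have h0 : ContDiffOn ℝ 1 φ U := hφ.of_le (by norm_cast)
  have hE : ContDiffOn ℝ 1 (fun z => Real.exp (-2 * φ z)) U := (contDiffOn_const.mul h0).exp
  have hN := (ha.pow 2).add (hb.pow 2)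
  exact ⟨hE.mul (((ha.mul hc).add (hb.mul hd)).sub (h1.mul hN)),
    hE.mul (((hb.mul hc).sub (ha.mul hd)).sub (h2.mul hN))⟩

/-- The magnetic gradient of `exp (-φ) w` for holomorphic `w`. -/
theorem mag_exp_neg_mul {φ : ℂ → ℝ} {w u : ℂ → ℂ} {z : ℂ} (hφ : DifferentiableAt ℝ φ z)
    (hw : DifferentiableAt ℂ w z) (hu : ∀ z : ℂ, u z = Complex.exp (-(φ z : ℂ)) * w z) :
    mag1 φ u z = (Real.exp (-φ z) : ℂ) *
      (-Complex.I * (deriv w z - (pd1R φ z - pd2R φ z * Complex.I) * w z)) ∧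
    mag2 φ u z = (Real.exp (-φ z) : ℂ) *
      (deriv w z - (pd1R φ z - pd2R φ z * Complex.I) * w z) := by
  have hue : u = fun z => Complex.exp (-(φ z : ℂ)) * w z := funext hu
  have hφc : HasFDerivAt (fun z => (φ z : ℂ)) _ z := Complex.ofRealCLM.hasFDerivAt.comp z hφ.hasFDerivAt
  have hud : fderiv ℝ (fun z => Complex.exp (-(φ z : ℂ)) * w z) z = _ :=
    (hφc.neg.cexp.mul (hw.hasDerivAt.hasFDerivAt.restrictScalars ℝ)).fderiv
  rw [← hue] at hud
  have hce : Complex.exp (-(φ z : ℂ)) = (Real.exp (-φ z) : ℂ) := by push_cast; rfl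
  constructor
  · rw [mag1, pd1, hud, hu z, hce]
    simp [A1f, pd1R, pd2R]
    linear_combination
      (Complex.exp (-(φ z : ℂ)) * w z * fderiv ℝ φ z Complex.I) * Complex.I_sq
  · rw [mag2, pd2, hud, hu z, hce]
    simp [A2f, pd1R, pd2R]
    linear_combination (-Complex.exp (-(φ z : ℂ)) * deriv w z) * Complex.I_sq

/-- The magnetic energy density of `exp (-φ) w` is a divergence. -/
theorem energy_density_eq_divergence {φ : ℂ → ℝ} {w u : ℂ → ℂ} {U : Set ℂ} (hU : IsOpen U)
    (hφ : ContDiffOn ℝ (⊤ : ℕ∞) φ U) (hw : DifferentiableOn ℂ w U)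
    (hu : ∀ z : ℂ, u z = Complex.exp (-(φ z : ℂ)) * w z) {z : ℂ} (hz : z ∈ U) :
    ‖mag1 φ u z‖ ^ 2 + ‖mag2 φ u z‖ ^ 2 - Bf φ z * ‖u z‖ ^ 2 =
      pd1R (halfGrad1 φ w) z + pd2R (halfGrad2 φ w) z := by
  have hzn := hU.mem_nhds hz
  have hwz := hw.differentiableAt hzn
  have hwz' := (hw.deriv hU).differentiableAt hzn
  have ha := hasFDerivAt_re_of_differentiableAt hwz
  have hb := hasFDerivAt_im_of_differentiableAt hwz
  have hc := hasFDerivAt_re_of_differentiableAt hwz'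
  have hd := hasFDerivAt_im_of_differentiableAt hwz'
  have h0 := ((hφ.differentiableOn (by simp)).differentiableAt hzn).hasFDerivAt
  have h1 := (((contDiffOn_pd1R hU hφ).differentiableOn one_ne_zero).differentiableAt
    hzn).hasFDerivAt
  have h2 := (((contDiffOn_pd2R hU hφ).differentiableOn one_ne_zero).differentiableAt
    hzn).hasFDerivAt
  have hE := (h0.const_mul (-2)).exp
  have hN := (ha.pow 2).add (hb.pow 2)
  have hV : fderiv ℝ (halfGrad1 φ w) z = _ :=
    (hE.mul (((ha.mul hc).add (hb.mul hd)).sub (h1.mul hN))).fderiv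
  have hW : fderiv ℝ (halfGrad2 φ w) z = _ :=
    (hE.mul (((hb.mul hc).sub (ha.mul hd)).sub (h2.mul hN))).fderiv
  have hexp : Real.exp (-(2 * φ z)) = Real.exp (-φ z) ^ 2 := by
    rw [← Real.exp_nat_mul]
    congr 1
    push_cast
    ring
  have hce : Complex.exp (-(φ z : ℂ)) = (Real.exp (-φ z) : ℂ) := by push_cast; rfl
  obtain ⟨hm1, hm2⟩ := mag_exp_neg_mul h0.differentiableAt hwz hu
  have hp1 : fderiv ℝ φ z 1 = pd1R φ z := rfl
  have hp2 : fderiv ℝ φ z Complex.I = pd2R φ z := rfl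
  have hp11 : fderiv ℝ (pd1R φ) z 1 = pd1R (pd1R φ) z := rfl
  have hp22 : fderiv ℝ (pd2R φ) z Complex.I = pd2R (pd2R φ) z := rfl
  rw [hm1, hm2, hu z, hce, Bf]
  change _ = fderiv ℝ (halfGrad1 φ w) z 1 + fderiv ℝ (halfGrad2 φ w) z Complex.I
  rw [hV, hW]
  simp only [Complex.sq_norm, Complex.normSq_apply, neg_mul 2 (φ z), hexp]
  generalize Real.exp (-φ z) = E
  simp [hp1, hp2, hp11, hp22]
  ring

/-- For `u = e^{-φ} w` with `w` holomorphic, the Robin quadratic form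
reduces to a boundary integral involving the twisted Dirac operator. -/
theorem stmt_7 (φ : ℂ → ℝ) (U : Set ℂ) (hU : IsOpen U)
    (hDU : Metric.closedBall (0:ℂ) 1 ⊆ U) (hφ : ContDiffOn ℝ (⊤ : ℕ∞) φ U)
    (hφ0 : ∀ z : ℂ, ‖z‖ = 1 → φ z = 0)
    (g : ℝ → ℝ) (hg : Continuous g) (hgper : ∀ θ, g (θ + 2 * Real.pi) = g θ)
    (w : ℂ → ℂ) (hw : DifferentiableOn ℂ w U)
    (u : ℂ → ℂ) (hu : ∀ z : ℂ, u z = Complex.exp (-(φ z : ℂ)) * w z)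
    (p : ℝ → ℂ) (hp : ∀ θ : ℝ, p θ = w (Complex.exp (Complex.I * θ))) :
    (∫ z in Metric.ball (0:ℂ) 1,
        (‖mag1 φ u z‖ ^ 2 + ‖mag2 φ u z‖ ^ 2 - Bf φ z * ‖u z‖ ^ 2))
      + (∫ θ in (0:ℝ)..(2 * Real.pi), g θ * ‖p θ‖ ^ 2)
    =
    (∫ θ in (0:ℝ)..(2 * Real.pi),
        ((-Complex.I * deriv p θ - (Atan φ θ : ℂ) * p θ + (g θ : ℂ) * p θ)
          * (starRingEnd ℂ) (p θ))).re := by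
  obtain ⟨hV, hW⟩ := contDiffOn_halfGrad hU hφ hw
  have hnorm (θ : ℝ) : ‖Complex.exp (Complex.I * θ)‖ = 1 := by
    rw [mul_comm, Complex.norm_exp_ofReal_mul_I]
  have hmem (θ : ℝ) : Complex.exp (Complex.I * θ) ∈ U :=
    hDU (mem_closedBall_zero_iff.2 (hnorm θ).le)
  have hec : Continuous fun θ : ℝ => Complex.exp (Complex.I * θ) := by fun_prop
  have hpc : Continuous p := by
    rw [funext hp]
    exact hw.continuousOn.comp_continuous hec hmem
  have hpd (θ : ℝ) : deriv p θ = deriv w (Complex.exp (Complex.I * θ)) *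
      (Complex.exp (Complex.I * θ) * Complex.I) := by
    have he : HasDerivAt (fun θ : ℝ => Complex.exp (Complex.I * θ))
        (Complex.exp (Complex.I * θ) * Complex.I) θ := by
      simpa using ((Complex.ofRealCLM.hasDerivAt (x := θ)).const_mul Complex.I).cexp
    rw [funext hp]
    exact ((hw.differentiableAt (hU.mem_nhds (hmem θ))).hasDerivAt.comp θ he).deriv
  have hpdc : Continuous (deriv p) := by
    rw [funext hpd]
    exact ((hw.deriv hU).continuousOn.comp_continuous hec hmem).mul
      (hec.mul continuous_const)
  have hAc : Continuous (Atan φ) :=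
    (Real.continuous_sin.neg.mul
      ((contDiffOn_pd2R hU hφ).continuousOn.comp_continuous hec hmem).neg).add
      (Real.continuous_cos.mul ((contDiffOn_pd1R hU hφ).continuousOn.comp_continuous hec hmem))
  have hR : Continuous fun θ => (-Complex.I * deriv p θ - (Atan φ θ : ℂ) * p θ + (g θ : ℂ) * p θ)
      * (starRingEnd ℂ) (p θ) := by
    have := Complex.continuous_conj.comp hpc
    fun_prop
  have hB : Continuous fun θ : ℝ => Real.cos θ * halfGrad1 φ w (Complex.exp (Complex.I * θ))
        + Real.sin θ * halfGrad2 φ w (Complex.exp (Complex.I * θ)) :=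
    (Real.continuous_cos.mul (hV.continuousOn.comp_continuous hec hmem)).add
      (Real.continuous_sin.mul (hW.continuousOn.comp_continuous hec hmem))
  have hG : Continuous fun θ => g θ * ‖p θ‖ ^ 2 := by fun_prop
  rw [setIntegral_congr_fun measurableSet_ball fun z hz =>
      energy_density_eq_divergence hU hφ hw hu (hDU (Metric.ball_subset_closedBall hz)),
    integral_ball_divergence _ _ U hU hDU hV hW,
    ← intervalIntegral.integral_add (hB.intervalIntegrable _ _) (hG.intervalIntegrable _ _),
    ← Complex.reCLM_apply,
    ← Complex.reCLM.intervalIntegral_comp_comm (hR.intervalIntegrable _ _)]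
  congr 1
  ext θ
  rw [Complex.reCLM_apply, hpd, hp, halfGrad1, halfGrad2, hφ0 _ (hnorm θ), Complex.sq_norm,
    Complex.normSq_apply, Atan, A1f, A2f]
  generalize w (Complex.exp (Complex.I * θ)) = a
  generalize deriv w (Complex.exp (Complex.I * θ)) = b
  simp [mul_comm Complex.I, Complex.exp_ofReal_mul_I_re, Complex.exp_ofReal_mul_I_im]
  simp only [Complex.cos_ofReal_re, Complex.sin_ofReal_re]
  ring
end

section
/- Let β ∈ ℝ, define φ(x) = (β/4)(|x|² − 1), A(x) = (β/2)(−x₂, x₁), and for an integer m ≥ 0 set u_m(x) = e^{−φ(x)} (x₁ + i x₂)^m. Then ∫_D ( |(−i∇ − A)u_m|² − β |u_m|² ) dx = 2π ( m − β/2 ). -/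
open MeasureTheory

/-- The real derivative of `e^{-(β/4)(|z|²-1)} z^m` in the direction `v`. -/
lemma fderiv_exp_mul_pow (β : ℝ) (m : ℕ) (u : ℂ → ℂ)
    (hu : ∀ z : ℂ, u z = Complex.exp (-((β / 4 * (‖z‖ ^ 2 - 1) : ℝ) : ℂ)) * z ^ m) (z v : ℂ) :
    fderiv ℝ u z v = Complex.exp (-((β / 4 * (‖z‖ ^ 2 - 1) : ℝ) : ℂ)) *
      (m * z ^ (m - 1) * v
        - β / 4 * (z * starRingEnd ℂ v + starRingEnd ℂ z * v) * z ^ m) := by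
  have hphi (w : ℂ) : -((β / 4 * (‖w‖ ^ 2 - 1) : ℝ) : ℂ)
      = -((β : ℂ) / 4) * (w * starRingEnd ℂ w - 1) := by
    rw [Complex.mul_conj']
    push_cast
    ring
  simp only [hphi] at hu ⊢
  obtain rfl : u = fun w => Complex.exp (-((β : ℂ) / 4) * (w * starRingEnd ℂ w - 1)) * w ^ m :=
    funext hu
  have hid : HasFDerivAt (fun w : ℂ => w) (ContinuousLinearMap.id ℝ ℂ) z := hasFDerivAt_id z
  have hconj : HasFDerivAt (fun w : ℂ => starRingEnd ℂ w)
      (Complex.conjCLE : ℂ →L[ℝ] ℂ) z := Complex.conjCLE.hasFDerivAt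
  have h := ((((hid.mul hconj).sub_const 1).const_mul (-((β : ℂ) / 4))).cexp).mul (hid.pow m)
  have h' := congrArg (fun L : ℂ →L[ℝ] ℂ => L v) h.fderiv
  refine h'.trans ?_
  simp
  ring

/-- The magnetic energy density of `e^{-(β/4)(|z|²-1)} z^m` is radial. -/
lemma magnetic_density_eq (β : ℝ) (m : ℕ) (u : ℂ → ℂ)
    (hu : ∀ z : ℂ, u z = Complex.exp (-((β / 4 * (‖z‖ ^ 2 - 1) : ℝ) : ℂ)) * z ^ m) (z : ℂ) :
    ‖-Complex.I * fderiv ℝ u z 1 - ((-(β / 2) * z.im : ℝ) : ℂ) * u z‖ ^ 2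
      + ‖-Complex.I * fderiv ℝ u z Complex.I - ((β / 2 * z.re : ℝ) : ℂ) * u z‖ ^ 2
      - β * ‖u z‖ ^ 2
    = Real.exp (-(β / 4 * (‖z‖ ^ 2 - 1))) ^ 2 *
      (2 * (m * ‖z‖ ^ (m - 1) - β / 2 * ‖z‖ ^ (m + 1)) ^ 2 - β * ‖z‖ ^ (2 * m)) := by
  set E : ℂ := Complex.exp (-((β / 4 * (‖z‖ ^ 2 - 1) : ℝ) : ℂ)) with hE
  have hnE : ‖E‖ = Real.exp (-(β / 4 * (‖z‖ ^ 2 - 1))) := by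
    rw [hE, ← Complex.ofReal_neg, ← Complex.ofReal_exp, Complex.norm_real, Real.norm_eq_abs,
      Real.abs_exp]
  set W : ℂ := m * z ^ (m - 1) - β / 2 * (starRingEnd ℂ z * z ^ m) with hW
  have hz : z = z.re + z.im * Complex.I := (Complex.re_add_im z).symm
  have hzc : starRingEnd ℂ z = z.re - z.im * Complex.I := by
    apply Complex.ext <;> simp
  have h1 : -Complex.I * fderiv ℝ u z 1 - ((-(β / 2) * z.im : ℝ) : ℂ) * u z
      = -Complex.I * (E * W) := by
    rw [fderiv_exp_mul_pow β m u hu, hu, ← hE, hW]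
    have : z - starRingEnd ℂ z = 2 * z.im * Complex.I := by rw [hzc]; nth_rw 1 [hz]; ring
    simp only [map_one]
    push_cast
    linear_combination (Complex.I * E * β / 4 * z ^ m) * this
      + (E * β / 2 * z.im * z ^ m) * Complex.I_sq
  have h2 : -Complex.I * fderiv ℝ u z Complex.I - ((β / 2 * z.re : ℝ) : ℂ) * u z = E * W := by
    rw [fderiv_exp_mul_pow β m u hu, hu, ← hE, hW]
    have : z + starRingEnd ℂ z = 2 * z.re := by rw [hzc]; nth_rw 1 [hz]; ring
    simp only [Complex.conj_I]
    push_cast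
    linear_combination (E * β / 4 * z ^ m) * this
      + (-E * m * z ^ (m - 1) + E * β / 4 * (starRingEnd ℂ z - z) * z ^ m) * Complex.I_sq
  have hnW : ‖W‖ ^ 2 = (m * ‖z‖ ^ (m - 1) - β / 2 * ‖z‖ ^ (m + 1)) ^ 2 := by
    rcases m with _ | k
    · simp [hW, mul_pow, div_pow]
    · have : W = ((((k + 1 : ℕ) : ℝ) - β / 2 * ‖z‖ ^ 2 : ℝ) : ℂ) * z ^ k := by
        rw [hW, pow_succ' z k, ← mul_assoc (starRingEnd ℂ z), Complex.conj_mul']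
        push_cast
        ring
      rw [this, norm_mul, norm_pow, Complex.norm_real, mul_pow, Real.norm_eq_abs, sq_abs]
      simp only [Nat.add_sub_cancel]
      ring
  rw [h1, h2, hu z, ← hE, norm_mul, norm_mul, norm_mul, norm_neg, Complex.norm_I, norm_pow, hnE,
    one_mul, mul_pow, hnW]
  ring

/-- The radial energy density, weighted by `r`, is an exact derivative. -/
lemma hasDerivAt_radial_energy (β : ℝ) (m : ℕ) (r : ℝ) :
    HasDerivAt (fun r : ℝ => Real.exp (-(β / 4 * (r ^ 2 - 1))) ^ 2 *
        (m * r ^ (2 * m) - β / 2 * r ^ (2 * m + 2)))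
      (r * (Real.exp (-(β / 4 * (r ^ 2 - 1))) ^ 2 *
        (2 * (m * r ^ (m - 1) - β / 2 * r ^ (m + 1)) ^ 2 - β * r ^ (2 * m)))) r := by
  have he := (((((hasDerivAt_id r).pow 2).sub_const 1).const_mul (β / 4)).neg.exp).pow 2
  have hp := (((hasDerivAt_id r).pow (2 * m)).const_mul (m : ℝ)).sub
    (((hasDerivAt_id r).pow (2 * m + 2)).const_mul (β / 2))
  refine (he.mul hp).congr_deriv ?_
  rcases m with _ | k
  · simp
    ring
  · simp only [id, Pi.pow_apply, Pi.neg_apply, Pi.sub_apply, Nat.add_sub_cancel,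
      show 2 * (k + 1) - 1 = 2 * k + 1 by omega,
      show 2 * (k + 1) + 2 - 1 = 2 * k + 3 by omega]
    push_cast
    ring

/-- Integration of a radial function over the unit disc. -/
lemma integral_ball_fun_norm (F : ℝ → ℝ) :
    ∫ z in Metric.ball (0 : ℂ) 1, F ‖z‖ = 2 * Real.pi * ∫ r in (0 : ℝ)..1, r * F r := by
  have h := integral_fun_norm_addHaar (volume : Measure ℂ) ((Set.Iio (1 : ℝ)).indicator F)
  have hl : (fun z : ℂ => (Set.Iio (1 : ℝ)).indicator F ‖z‖)
      = (Metric.ball (0 : ℂ) 1).indicator (fun z => F ‖z‖) := by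
    ext z
    by_cases hz : ‖z‖ < 1 <;> simp [hz]
  rw [hl, integral_indicator Metric.isOpen_ball.measurableSet] at h
  have hr : ∫ y in Set.Ioi (0 : ℝ), y ^ (Module.finrank ℝ ℂ - 1) • (Set.Iio (1 : ℝ)).indicator F y
      = ∫ r in (0 : ℝ)..1, r * F r := by
    have : (fun y : ℝ => y ^ (Module.finrank ℝ ℂ - 1) • (Set.Iio (1 : ℝ)).indicator F y)
        = (Set.Iio (1 : ℝ)).indicator (fun y => y * F y) := by
      ext y
      simp [Complex.finrank_real_complex, Set.indicator_apply]
    rw [this, setIntegral_indicator measurableSet_Iio, Set.Ioi_inter_Iio,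
      intervalIntegral.integral_of_le zero_le_one, integral_Ioc_eq_integral_Ioo]
  rw [h, hr, Complex.finrank_real_complex]
  simp [Measure.real, Complex.volume_ball]
  ring

/-- Boundary term computation on the unit disc with uniform field `β`:
for `u_m = e^{-φ} z^m` with `φ = (β/4)(|z|²-1)`, the magnetic quadratic form
equals `2π(m - β/2)`. -/
theorem stmt_8 (β : ℝ) (m : ℕ)
    (φ : ℂ → ℝ) (hφ : ∀ z : ℂ, φ z = (β / 4) * (‖z‖ ^ 2 - 1))
    (A1 A2 : ℂ → ℝ)
    (hA1 : ∀ z : ℂ, A1 z = -(β / 2) * z.im) (hA2 : ∀ z : ℂ, A2 z = (β / 2) * z.re)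
    (u : ℂ → ℂ) (hu : ∀ z : ℂ, u z = Complex.exp (-(φ z : ℂ)) * z ^ m) :
    (∫ z in Metric.ball (0:ℂ) 1,
        (‖-Complex.I * fderiv ℝ u z 1 - (A1 z : ℂ) * u z‖ ^ 2
          + ‖-Complex.I * fderiv ℝ u z Complex.I - (A2 z : ℂ) * u z‖ ^ 2
          - β * ‖u z‖ ^ 2))
    = 2 * Real.pi * ((m : ℝ) - β / 2) := by
  simp only [hφ] at hu
  simp only [hA1, hA2, magnetic_density_eq β m u hu]
  rw [integral_ball_fun_norm (fun r => Real.exp (-(β / 4 * (r ^ 2 - 1))) ^ 2 *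
      (2 * (m * r ^ (m - 1) - β / 2 * r ^ (m + 1)) ^ 2 - β * r ^ (2 * m))),
    intervalIntegral.integral_eq_sub_of_hasDerivAt
      (fun r _ => hasDerivAt_radial_energy β m r)
      (Continuous.intervalIntegrable (by fun_prop) _ _)]
  rcases m with _ | k <;> simp
end

section
/- Let U ⊆ ℂ be open, F : U → ℂ holomorphic, and A = (A₁, A₂) a real C¹ vector field on an open set containing F(U). Identify ℂ with ℝ², let DF(z) be the real 2×2 Jacobian of F at z, and define Ã(z) = DF(z)ᵀ · A(F(z)). Then for every z ∈ U: ∂₁Ã₂(z) − ∂₂Ã₁(z) = |F′(z)|² · ( ∂₁A₂ − ∂₂A₁ )(F(z)). -/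
/-- Derivative in direction `v` of the component along `u` of the pullback of a real vector field
by a holomorphic map. -/
theorem fderiv_pullback_component {F : ℂ → ℂ} {z : ℂ} (hF : AnalyticAt ℂ F z)
    {A1 A2 : ℂ → ℝ} (hA1 : DifferentiableAt ℝ A1 (F z)) (hA2 : DifferentiableAt ℝ A2 (F z))
    {B : ℂ → ℝ} (u v : ℂ)
    (hB : ∀ w, B w = (fderiv ℝ F w u).re * A1 (F w) + (fderiv ℝ F w u).im * A2 (F w)) :
    fderiv ℝ B z v
      = (v * deriv (deriv F) z * u).re * A1 (F z)
        + (deriv F z * u).re * fderiv ℝ A1 (F z) (v * deriv F z)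
        + (v * deriv (deriv F) z * u).im * A2 (F z)
        + (deriv F z * u).im * fderiv ℝ A2 (F z) (v * deriv F z) := by
  have hloc : B =ᶠ[nhds z]
      fun w => (deriv F w * u).re * A1 (F w) + (deriv F w * u).im * A2 (F w) := by
    filter_upwards [hF.eventually_analyticAt] with w hw
    have h := hw.differentiableAt.hasDerivAt.hasFDerivAt.restrictScalars ℝ
    rw [hB w, h.fderiv]
    simp [mul_comm]
  have hFz := hF.differentiableAt.hasDerivAt.hasFDerivAt.restrictScalars ℝ
  have hd := (hF.deriv.differentiableAt.hasDerivAt.mul_const u).hasFDerivAt.restrictScalars ℝ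
  have hre := Complex.reCLM.hasFDerivAt.comp z hd
  have him := Complex.imCLM.hasFDerivAt.comp z hd
  have hc1 := hA1.hasFDerivAt.comp z hFz
  have hc2 := hA2.hasFDerivAt.comp z hFz
  have h := (hre.mul hc1).add (him.mul hc2)
  have h' := (h.congr_of_eventuallyEq hloc).fderiv
  rw [h']
  simp [mul_assoc]
  ring

/-- A real-linear functional on `ℂ` is determined by its values at `1` and `I`. -/
theorem ContinuousLinearMap.apply_eq_re_im (L : ℂ →L[ℝ] ℝ) (c : ℂ) :
    L c = c.re * L 1 + c.im * L Complex.I := by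
  have h : c = c.re • (1 : ℂ) + c.im • Complex.I := by
    simp [Complex.re_add_im]
  conv_lhs => rw [h]
  simp only [map_add, map_smul, smul_eq_mul]

/-- Conformal transformation law for the magnetic field: if `Ã = DFᵀ (A ∘ F)`
for a holomorphic `F`, then `curl Ã = |F′|² (curl A) ∘ F`. -/
theorem stmt_13 (U W : Set ℂ) (hU : IsOpen U) (hW : IsOpen W)
    (F : ℂ → ℂ) (hF : DifferentiableOn ℂ F U) (hFW : F '' U ⊆ W)
    (A1 A2 : ℂ → ℝ) (hA1 : ContDiffOn ℝ 1 A1 W) (hA2 : ContDiffOn ℝ 1 A2 W)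
    (At1 At2 : ℂ → ℝ)
    (hAt1 : ∀ z : ℂ, At1 z
      = (fderiv ℝ F z 1).re * A1 (F z) + (fderiv ℝ F z 1).im * A2 (F z))
    (hAt2 : ∀ z : ℂ, At2 z
      = (fderiv ℝ F z Complex.I).re * A1 (F z) + (fderiv ℝ F z Complex.I).im * A2 (F z)) :
    ∀ z ∈ U,
      fderiv ℝ At2 z 1 - fderiv ℝ At1 z Complex.I
        = ‖deriv F z‖ ^ 2
          * (fderiv ℝ A2 (F z) 1 - fderiv ℝ A1 (F z) Complex.I) := by
  intro z hz
  have hFz : F z ∈ W := hFW ⟨z, hz, rfl⟩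
  have hd1 : DifferentiableAt ℝ A1 (F z) :=
    (hA1.differentiableOn one_ne_zero).differentiableAt (hW.mem_nhds hFz)
  have hd2 : DifferentiableAt ℝ A2 (F z) :=
    (hA2.differentiableOn one_ne_zero).differentiableAt (hW.mem_nhds hFz)
  have hFa : AnalyticAt ℂ F z := hF.analyticAt (hU.mem_nhds hz)
  rw [fderiv_pullback_component hFa hd1 hd2 Complex.I 1 hAt2,
    fderiv_pullback_component hFa hd1 hd2 1 Complex.I hAt1,
    (fderiv ℝ A1 (F z)).apply_eq_re_im (1 * deriv F z),
    (fderiv ℝ A2 (F z)).apply_eq_re_im (1 * deriv F z),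
    (fderiv ℝ A1 (F z)).apply_eq_re_im (Complex.I * deriv F z),
    (fderiv ℝ A2 (F z)).apply_eq_re_im (Complex.I * deriv F z),
    Complex.sq_norm, Complex.normSq_apply]
  simp only [one_mul, mul_one, Complex.mul_re, Complex.mul_im, Complex.I_re, Complex.I_im]
  ring
end

section
/- Let φ be a smooth real-valued function on an open neighbourhood of the closed unit disc with φ = 0 on the unit circle, set A = (−∂₂φ, ∂₁φ), and assume the magnetic field B = Δφ is ≥ 0 on the closed unit disc with Φ = (1/(2π)) ∫_D B dx > 0. Then for every complex-valued function u that is smooth on an open neighbourhood of the closed unit disc such that e^{φ} u is anti-holomorphic on D (i.e., ∂_z(e^{φ}u) = 0 on D, where ∂_z = (∂₁ − i∂₂)/2), u not identically zero implies ∫_D ( |(−i∇ − A)u|² + B |u|² ) dx > 0. -/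
open MeasureTheory

theorem ContDiffOn.fderiv_apply_const_of_isOpen {F : Type*} [NormedAddCommGroup F]
    [NormedSpace ℝ F] {f : ℂ → F} {U : Set ℂ} (hf : ContDiffOn ℝ (⊤ : ℕ∞) f U) (hU : IsOpen U)
    (v : ℂ) : ContDiffOn ℝ (⊤ : ℕ∞) (fun z => fderiv ℝ f z v) U :=
  (hf.fderiv_of_isOpen hU (by simp)).clm_apply contDiffOn_const

theorem continuousOn_Bf {φ : ℂ → ℝ} {U : Set ℂ} (hU : IsOpen U)
    (hφ : ContDiffOn ℝ (⊤ : ℕ∞) φ U) : ContinuousOn (Bf φ) U :=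
  (((hφ.fderiv_apply_const_of_isOpen hU 1).fderiv_apply_const_of_isOpen hU 1).add
    ((hφ.fderiv_apply_const_of_isOpen hU Complex.I).fderiv_apply_const_of_isOpen hU
      Complex.I)).continuousOn

theorem continuousOn_mag1 {φ : ℂ → ℝ} {u : ℂ → ℂ} {U : Set ℂ} (hU : IsOpen U)
    (hφ : ContDiffOn ℝ (⊤ : ℕ∞) φ U) (hu : ContDiffOn ℝ (⊤ : ℕ∞) u U) :
    ContinuousOn (mag1 φ u) U :=
  (continuousOn_const.mul (hu.fderiv_apply_const_of_isOpen hU 1).continuousOn).sub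
    ((Complex.continuous_ofReal.comp_continuousOn
      (hφ.fderiv_apply_const_of_isOpen hU Complex.I).continuousOn.neg).mul hu.continuousOn)

theorem continuousOn_mag2 {φ : ℂ → ℝ} {u : ℂ → ℂ} {U : Set ℂ} (hU : IsOpen U)
    (hφ : ContDiffOn ℝ (⊤ : ℕ∞) φ U) (hu : ContDiffOn ℝ (⊤ : ℕ∞) u U) :
    ContinuousOn (mag2 φ u) U :=
  (continuousOn_const.mul (hu.fderiv_apply_const_of_isOpen hU Complex.I).continuousOn).sub
    ((Complex.continuous_ofReal.comp_continuousOn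
      (hφ.fderiv_apply_const_of_isOpen hU 1).continuousOn).mul hu.continuousOn)

/-- The conjugate of an anti-holomorphic function is holomorphic. -/
theorem differentiableAt_conj_of_pd_eq_zero {v : ℂ → ℂ} {z : ℂ} (hv : DifferentiableAt ℝ v z)
    (h : (pd1 v z - Complex.I * pd2 v z) / 2 = 0) :
    DifferentiableAt ℂ (fun w => (starRingEnd ℂ) (v w)) z := by
  have hd : HasFDerivAt (fun w => (starRingEnd ℂ) (v w))
      ((Complex.conjCLE : ℂ →L[ℝ] ℂ).comp (fderiv ℝ v z)) z :=
    (Complex.conjCLE : ℂ →L[ℝ] ℂ).hasFDerivAt.comp z hv.hasFDerivAt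
  refine differentiableAt_complex_iff_differentiableAt_real.2 ⟨hd.differentiableAt, ?_⟩
  have h1 : fderiv ℝ v z 1 = Complex.I * fderiv ℝ v z Complex.I := by
    simpa [pd1, pd2, sub_eq_zero] using h
  rw [hd.fderiv]
  simp [h1, ← mul_assoc]

/-- An anti-holomorphic function on a preconnected open set that vanishes near a point of the set
vanishes on the whole set. -/
theorem eqOn_zero_of_antiholomorphic {v : ℂ → ℂ} {V : Set ℂ} (hV : IsOpen V)
    (hV' : IsPreconnected V) (hv : ∀ z ∈ V, DifferentiableAt ℝ v z)
    (h : ∀ z ∈ V, (pd1 v z - Complex.I * pd2 v z) / 2 = 0) {z₀ : ℂ} (hz₀ : z₀ ∈ V)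
    (h0 : ∀ᶠ z in nhds z₀, v z = 0) : Set.EqOn v 0 V := by
  have hd : DifferentiableOn ℂ (fun w => (starRingEnd ℂ) (v w)) V := fun z hz =>
    (differentiableAt_conj_of_pd_eq_zero (hv z hz) (h z hz)).differentiableWithinAt
  intro z hz
  have := (hd.analyticOnNhd hV).eqOn_zero_of_preconnected_of_eventuallyEq_zero hV' hz₀
    (by filter_upwards [h0] with w hw; simp [hw]) hz
  simpa using this

/-- Positivity of the spin-down (Neumann) Pauli quadratic form on weighted
anti-holomorphic functions, for a nonnegative magnetic field of positive flux. -/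
theorem stmt_19 (φ : ℂ → ℝ) (U : Set ℂ) (hU : IsOpen U)
    (hDU : Metric.closedBall (0:ℂ) 1 ⊆ U) (hφ : ContDiffOn ℝ (⊤ : ℕ∞) φ U)
    (hφ0 : ∀ z : ℂ, ‖z‖ = 1 → φ z = 0)
    (hB : ∀ z ∈ Metric.closedBall (0:ℂ) 1, 0 ≤ Bf φ z)
    (hΦ : 0 < (1 / (2 * Real.pi)) * ∫ z in Metric.ball (0:ℂ) 1, Bf φ z)
    (u : ℂ → ℂ) (hu : ContDiffOn ℝ (⊤ : ℕ∞) u U)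
    (hanti : ∀ z ∈ Metric.ball (0:ℂ) 1,
      (pd1 (fun w => Complex.exp ((φ w : ℂ)) * u w) z
        - Complex.I * pd2 (fun w => Complex.exp ((φ w : ℂ)) * u w) z) / 2 = 0)
    (hne : ∃ z ∈ Metric.ball (0:ℂ) 1, u z ≠ 0) :
    0 < ∫ z in Metric.ball (0:ℂ) 1,
      (‖mag1 φ u z‖ ^ 2 + ‖mag2 φ u z‖ ^ 2 + Bf φ z * ‖u z‖ ^ 2) := by
  set D := Metric.ball (0 : ℂ) 1
  have hDC : D ⊆ Metric.closedBall (0 : ℂ) 1 := Metric.ball_subset_closedBall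
  have hBc := continuousOn_Bf hU hφ
  set F : ℂ → ℝ := fun z => ‖mag1 φ u z‖ ^ 2 + ‖mag2 φ u z‖ ^ 2 + Bf φ z * ‖u z‖ ^ 2 with hF
  have hFc : ContinuousOn F U :=
    (((continuousOn_mag1 hU hφ hu).norm.pow 2).add ((continuousOn_mag2 hU hφ hu).norm.pow 2)).add
      (hBc.mul (hu.continuousOn.norm.pow 2))
  have hFi : IntegrableOn F D :=
    ((hFc.mono hDU).integrableOn_compact (isCompact_closedBall 0 1)).mono_set hDC
  have hF0 : ∀ z ∈ D, 0 ≤ F z := fun z hz => by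
    have := hB z (hDC hz)
    positivity
  obtain ⟨z₀, hz₀, hBz₀⟩ : ∃ z ∈ D, 0 < Bf φ z := by
    by_contra! hle
    have : ∫ z in D, Bf φ z ≤ 0 := setIntegral_nonpos measurableSet_ball hle
    exact hΦ.not_ge (mul_nonpos_of_nonneg_of_nonpos (by positivity) this)
  have hF0ae : 0 ≤ᵐ[volume.restrict D] F :=
    (ae_restrict_iff' measurableSet_ball).2 (Filter.Eventually.of_forall hF0)
  refine (integral_nonneg_of_ae hF0ae).lt_of_ne' fun hzero => ?_
  have hFz : Set.EqOn F 0 D :=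
    Measure.eqOn_open_of_ae_eq ((setIntegral_eq_zero_iff_of_nonneg_ae hF0ae hFi).1 hzero)
      Metric.isOpen_ball (hFc.mono (hDC.trans hDU)) continuousOn_const
  have hev : ∀ᶠ z in nhds z₀, u z = 0 := by
    filter_upwards [Metric.isOpen_ball.mem_nhds hz₀,
      (hBc.continuousAt (hU.mem_nhds (hDU (hDC hz₀)))).eventually_const_lt hBz₀] with z hz hBz
    by_contra hne0
    have h1 : 0 < Bf φ z * ‖u z‖ ^ 2 := by positivity
    have h2 : F z = 0 := hFz hz
    have h3 : 0 ≤ ‖mag1 φ u z‖ ^ 2 + ‖mag2 φ u z‖ ^ 2 := by positivity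
    simp only [hF] at h2
    linarith
  obtain ⟨z, hz, huz⟩ := hne
  have hdiff : ∀ w ∈ D, DifferentiableAt ℝ (fun w => Complex.exp ((φ w : ℂ)) * u w) w := by
    intro w hw
    have hwU := hU.mem_nhds (hDU (hDC hw))
    have hφw : DifferentiableAt ℝ φ w := (hφ.contDiffAt hwU).differentiableAt (by simp)
    have huw : DifferentiableAt ℝ u w := (hu.contDiffAt hwU).differentiableAt (by simp)
    exact (Complex.ofRealCLM.differentiableAt.comp w hφw).cexp.mul huw
  have := eqOn_zero_of_antiholomorphic Metric.isOpen_ball (convex_ball 0 1).isPreconnected hdiff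
    hanti hz₀ (by filter_upwards [hev] with w hw; simp [hw]) hz
  exact huz (by simpa using this)
end
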